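/- Let A and B be symmetric d×d real matrices and c > 0 a constant. Suppose that ⟨Aξ,ξ⟩ − ⟨Bη,η⟩ ≤ c|ξ − η|² for all ξ, η ∈ ℝ^d. Then B + cI is positive semidefinite, B + 2cI is positive definite, and A ⪯ 2c·B(B + 2cI)^{−1} in the Loewner order (the right-hand side is a symmetric matrix since B and (B+2cI)^{−1} commute). -/

import Mathlib

open MeasureTheory Filter Metric Set
open scoped Topology ENNReal NNReal InnerProductSpace RealInnerProductSpace

noncomputable section

attribute [local instance] Matrix.normedAddCommGroup Matrix.normedSpace

namespace Krylov

/-- Euclidean space `ℝ^d`. -/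
abbrev E (d : ℕ) := EuclideanSpace ℝ (Fin d)

/-- Type of fully nonlinear operators `H(u', u'', (t,x))`. -/
abbrev Ham (d : ℕ) := E (d + 1) → Matrix (Fin d) (Fin d) ℝ → ℝ × E d → ℝ

def esingle {d : ℕ} (i : Fin d) : E d := EuclideanSpace.single i 1

/-- Assemble `u' = (u'_0, [u'])`. -/
def vcons {d : ℕ} (r : ℝ) (b : E d) : E (d + 1) :=
  (EuclideanSpace.equiv (Fin (d + 1)) ℝ).symm (Fin.cons r (fun i => b i))

/-- The set `𝕊_δ` of symmetric matrices with eigenvalues in `[δ, δ⁻¹]`. -/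
def Sdelta (d : ℕ) (δ : ℝ) : Set (Matrix (Fin d) (Fin d) ℝ) :=
  {a | a.IsSymm ∧ ∀ lam : Fin d → ℝ,
      δ * (∑ i, lam i ^ 2) ≤ ∑ i, ∑ j, a i j * lam i * lam j ∧
      ∑ i, ∑ j, a i j * lam i * lam j ≤ δ⁻¹ * (∑ i, lam i ^ 2)}

/-- Frobenius norm `|u''| = (tr u'' u'')^{1/2}` of a matrix. -/
def frob {d : ℕ} (A : Matrix (Fin d) (Fin d) ℝ) : ℝ :=
  Real.sqrt (∑ i, ∑ j, (A i j) ^ 2)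

/-- Time derivative `∂_t u`. -/
def tderiv {d : ℕ} (u : ℝ × E d → ℝ) (p : ℝ × E d) : ℝ :=
  deriv (fun s => u (s, p.2)) p.1

/-- Spatial gradient `Du`. -/
def sgrad {d : ℕ} (u : ℝ × E d → ℝ) (p : ℝ × E d) : E d :=
  (EuclideanSpace.equiv (Fin d) ℝ).symm (fun i => fderiv ℝ (fun y => u (p.1, y)) p.2 (esingle i))

/-- Spatial Hessian `D²u`. -/
def shess {d : ℕ} (u : ℝ × E d → ℝ) (p : ℝ × E d) : Matrix (Fin d) (Fin d) ℝ :=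
  fun i j => fderiv ℝ (fun y => fderiv ℝ (fun z => u (p.1, z)) y (esingle j)) p.2 (esingle i)

/-- The operator `H[u](t,x) = H(u, Du, D²u, t, x)`. -/
def Hop {d : ℕ} (H : Ham d) (u : ℝ × E d → ℝ) (p : ℝ × E d) : ℝ :=
  H (vcons (u p) (sgrad u p)) (shess u p) p

/-- `C^{1,2}` regularity on a set: pointwise differentiability together with
continuity of `∂_t u`, `Du`, `D²u` on the set. -/
def C12On {d : ℕ} (u : ℝ × E d → ℝ) (Q : Set (ℝ × E d)) : Prop :=
  ContinuousOn u Q ∧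
  (∀ p ∈ Q, DifferentiableAt ℝ (fun s => u (s, p.2)) p.1) ∧
  (∀ p ∈ Q, DifferentiableAt ℝ (fun y => u (p.1, y)) p.2) ∧
  (∀ p ∈ Q, DifferentiableAt ℝ (fun y => fderiv ℝ (fun z => u (p.1, z)) y) p.2) ∧
  ContinuousOn (tderiv u) Q ∧ ContinuousOn (sgrad u) Q ∧ ContinuousOn (shess u) Q

/-- The parabolic cylinder `C_r(t,x) = (t,x) + [0,r²) × B_r`. -/
def cylSet {d : ℕ} (r : ℝ) (p : ℝ × E d) : Set (ℝ × E d) :=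
  Set.Ico p.1 (p.1 + r ^ 2) ×ˢ Metric.ball p.2 r

/-- The domain `Π = [0,T) × Ω`. -/
def PiDom {d : ℕ} (T : ℝ) (Ω : Set (E d)) : Set (ℝ × E d) :=
  Set.Ico 0 T ×ˢ Ω

/-- The parabolic boundary `∂'Π = ({T} × Ω̄) ∪ ([0,T] × ∂Ω)`. -/
def parBdry {d : ℕ} (T : ℝ) (Ω : Set (E d)) : Set (ℝ × E d) :=
  ({T} ×ˢ closure Ω) ∪ (Set.Icc 0 T ×ˢ frontier Ω)

/-- `Ω^ρ = {x : dist(x, Ωᶜ) > ρ}`. -/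
def OmRho {d : ℕ} (ρ : ℝ) (Ω : Set (E d)) : Set (E d) :=
  {x | ρ < Metric.infDist x Ωᶜ}

/-- `Π^ρ = [0, T-ρ²] × Ω^ρ`. -/
def PiRho {d : ℕ} (T ρ : ℝ) (Ω : Set (E d)) : Set (ℝ × E d) :=
  Set.Icc 0 (T - ρ ^ 2) ×ˢ OmRho ρ Ω

/-- The parabolic boundary of the cylinder `C_r(t,x)`. -/
def parCylBdry {d : ℕ} (r : ℝ) (p : ℝ × E d) : Set (ℝ × E d) :=
  ({p.1 + r ^ 2} ×ˢ closure (Metric.ball p.2 r)) ∪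
    (Set.Icc p.1 (p.1 + r ^ 2) ×ˢ Metric.sphere p.2 r)

/-- A bounded domain of class `C^{1,1}`: near every boundary point, `Ω` is the
region above the graph of a differentiable function with Lipschitz gradient. -/
def IsC11Domain {d : ℕ} (Ω : Set (E d)) : Prop :=
  IsOpen Ω ∧ IsConnected Ω ∧ Bornology.IsBounded Ω ∧
  ∀ x ∈ frontier Ω, ∃ r > 0, ∃ ν : E d, ‖ν‖ = 1 ∧ ∃ f : E d → ℝ,
    Differentiable ℝ f ∧ (∃ C : ℝ≥0, LipschitzWith C (fun y => fderiv ℝ f y)) ∧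
    ∀ y ∈ Metric.ball x r, (y ∈ Ω ↔ f (y - x - ⟪y - x, ν⟫_ℝ • ν) < ⟪y - x, ν⟫_ℝ)

/-- Essential supremum (in `EReal`) of `f` over `s`. -/
def pEssSup {d : ℕ} (f : ℝ × E d → ℝ) (s : Set (ℝ × E d)) : EReal :=
  essSup (fun p => (f p : EReal)) (volume.restrict s)

/-- Essential infimum (in `EReal`) of `f` over `s`. -/
def pEssInf {d : ℕ} (f : ℝ × E d → ℝ) (s : Set (ℝ × E d)) : EReal :=
  essInf (fun p => (f p : EReal)) (volume.restrict s)

/-- `C`-viscosity subsolution of `∂_t u + H[u] = 0` in `Q`. -/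
def IsCViscSubsol {d : ℕ} (H : Ham d) (Q : Set (ℝ × E d)) (u : ℝ × E d → ℝ) : Prop :=
  ContinuousOn u Q ∧
  ∀ (p₀ : ℝ × E d) (r : ℝ), 0 < r → closure (cylSet r p₀) ⊆ Q →
    ∀ φ : ℝ × E d → ℝ, C12On φ (cylSet r p₀) →
      IsMaxOn (fun p => u p - φ p) (cylSet r p₀) p₀ →
      (0 : EReal) ≤ Filter.limsup (fun ρ : ℝ =>
        pEssSup (fun p => tderiv φ p + H (vcons (u p) (sgrad φ p)) (shess φ p) p)
          (cylSet ρ p₀)) (𝓝[>] 0)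

/-- `C`-viscosity supersolution of `∂_t u + H[u] = 0` in `Q`. -/
def IsCViscSupersol {d : ℕ} (H : Ham d) (Q : Set (ℝ × E d)) (u : ℝ × E d → ℝ) : Prop :=
  ContinuousOn u Q ∧
  ∀ (p₀ : ℝ × E d) (r : ℝ), 0 < r → closure (cylSet r p₀) ⊆ Q →
    ∀ φ : ℝ × E d → ℝ, C12On φ (cylSet r p₀) →
      IsMinOn (fun p => u p - φ p) (cylSet r p₀) p₀ →
      Filter.liminf (fun ρ : ℝ =>
        pEssInf (fun p => tderiv φ p + H (vcons (u p) (sgrad φ p)) (shess φ p) p)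
          (cylSet ρ p₀)) (𝓝[>] 0) ≤ (0 : EReal)

def IsCViscSol {d : ℕ} (H : Ham d) (Q : Set (ℝ × E d)) (u : ℝ × E d → ℝ) : Prop :=
  IsCViscSubsol H Q u ∧ IsCViscSupersol H Q u

/-- `ut`, `ux`, `uxx` are the generalized (weak) derivatives of `u` on `Q`. -/
def WeakDerivs {d : ℕ} (Q : Set (ℝ × E d)) (u ut : ℝ × E d → ℝ)
    (ux : ℝ × E d → E d) (uxx : ℝ × E d → Matrix (Fin d) (Fin d) ℝ) : Prop :=
  ∀ ψ : ℝ × E d → ℝ, ContDiff ℝ (⊤ : ℕ∞) ψ → HasCompactSupport ψ → tsupport ψ ⊆ interior Q →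
    ((∫ p in Q, u p * fderiv ℝ ψ p ((1 : ℝ), (0 : E d))) = -∫ p in Q, ut p * ψ p) ∧
    (∀ i, (∫ p in Q, u p * fderiv ℝ ψ p ((0 : ℝ), esingle i)) = -∫ p in Q, ux p i * ψ p) ∧
    (∀ i j, (∫ p in Q,
        u p * fderiv ℝ (fun q => fderiv ℝ ψ q ((0 : ℝ), esingle j)) p ((0 : ℝ), esingle i))
      = ∫ p in Q, uxx p i j * ψ p)

def MemLpOn {d : ℕ} (q : ℝ) (Q : Set (ℝ × E d)) (f : ℝ × E d → ℝ) : Prop :=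
  MemLp f (ENNReal.ofReal q) (volume.restrict Q)

/-- `u` together with the derivatives `ut, ux, uxx` is of class `L_q` on `Q`. -/
def LpAll {d : ℕ} (q : ℝ) (Q : Set (ℝ × E d)) (u ut : ℝ × E d → ℝ)
    (ux : ℝ × E d → E d) (uxx : ℝ × E d → Matrix (Fin d) (Fin d) ℝ) : Prop :=
  MemLpOn q Q u ∧ MemLpOn q Q ut ∧ (∀ i, MemLpOn q Q (fun p => ux p i)) ∧
  (∀ i j, MemLpOn q Q (fun p => uxx p i j))

/-- `φ ∈ W^{1,2}_q(Q)` with weak derivatives `φt, φx, φxx`. -/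
def MemW12 {d : ℕ} (q : ℝ) (Q : Set (ℝ × E d)) (φ φt : ℝ × E d → ℝ)
    (φx : ℝ × E d → E d) (φxx : ℝ × E d → Matrix (Fin d) (Fin d) ℝ) : Prop :=
  WeakDerivs Q φ φt φx φxx ∧ LpAll q Q φ φt φx φxx

/-- `L_q`-viscosity subsolution of `∂_t u + H[u] = 0` in `Q`. -/
def IsLqViscSubsol {d : ℕ} (q : ℝ) (H : Ham d) (Q : Set (ℝ × E d)) (u : ℝ × E d → ℝ) : Prop :=
  ContinuousOn u Q ∧
  ∀ (p₀ : ℝ × E d) (r : ℝ), 0 < r → closure (cylSet r p₀) ⊆ Q →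
    ∀ (φ φt : ℝ × E d → ℝ) (φx : ℝ × E d → E d) (φxx : ℝ × E d → Matrix (Fin d) (Fin d) ℝ),
      ContinuousOn φ (cylSet r p₀) → MemW12 q (cylSet r p₀) φ φt φx φxx →
      IsMaxOn (fun p => u p - φ p) (cylSet r p₀) p₀ →
      (0 : EReal) ≤ Filter.limsup (fun ρ : ℝ =>
        pEssSup (fun p => φt p + H (vcons (u p) (φx p)) (φxx p) p) (cylSet ρ p₀)) (𝓝[>] 0)

/-- `L_q`-viscosity supersolution of `∂_t u + H[u] = 0` in `Q`. -/
def IsLqViscSupersol {d : ℕ} (q : ℝ) (H : Ham d) (Q : Set (ℝ × E d)) (u : ℝ × E d → ℝ) : Prop :=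
  ContinuousOn u Q ∧
  ∀ (p₀ : ℝ × E d) (r : ℝ), 0 < r → closure (cylSet r p₀) ⊆ Q →
    ∀ (φ φt : ℝ × E d → ℝ) (φx : ℝ × E d → E d) (φxx : ℝ × E d → Matrix (Fin d) (Fin d) ℝ),
      ContinuousOn φ (cylSet r p₀) → MemW12 q (cylSet r p₀) φ φt φx φxx →
      IsMinOn (fun p => u p - φ p) (cylSet r p₀) p₀ →
      Filter.liminf (fun ρ : ℝ =>
        pEssInf (fun p => φt p + H (vcons (u p) (φx p)) (φxx p) p) (cylSet ρ p₀)) (𝓝[>] 0)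
        ≤ (0 : EReal)

def IsLqViscSol {d : ℕ} (q : ℝ) (H : Ham d) (Q : Set (ℝ × E d)) (u : ℝ × E d → ℝ) : Prop :=
  IsLqViscSubsol q H Q u ∧ IsLqViscSupersol q H Q u

/-- Assumption 2.1: continuity, Lipschitz continuity in `𝐮` with constant `K₀`,
uniform ellipticity (`D_{u''}H ∈ 𝕊_δ`), Hölder regularity in `x` with exponent `γ`,
and boundedness of `H(0,·)` by `Hb`. -/
def AssumptionA {d : ℕ} (δ K₀ γ : ℝ) (H : Ham d) (ω : ℝ → ℝ) (Hb : ℝ) : Prop :=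
  Continuous (fun q : E (d + 1) × Matrix (Fin d) (Fin d) ℝ × (ℝ × E d) => H q.1 q.2.1 q.2.2) ∧
  (∀ u₁ u₂ A₁ A₂ p, |H u₁ A₁ p - H u₂ A₂ p| ≤ K₀ * (‖u₁ - u₂‖ + frob (A₁ - A₂))) ∧
  (∀ (u' : E (d + 1)) (p : ℝ × E d) (A : Matrix (Fin d) (Fin d) ℝ),
    DifferentiableAt ℝ (fun B => H u' B p) A →
    ∃ a ∈ Sdelta d δ, ∀ B, fderiv ℝ (fun B => H u' B p) A B = ∑ i, ∑ j, a i j * B i j) ∧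
  (∀ (u' : E (d + 1)) (A : Matrix (Fin d) (Fin d) ℝ) (t : ℝ) (x y : E d),
    |H u' A (t, x) - H u' A (t, y)| ≤ K₀ * ‖x - y‖ ^ γ * frob A + (‖u'‖ + 1) * ω ‖x - y‖) ∧
  Continuous ω ∧ ω 0 = 0 ∧ (∀ p, |H 0 0 p| ≤ Hb)

/-- `D_{u'_0} H ≤ -1` wherever the derivative exists. -/
def DerU0LeNegOne {d : ℕ} (H : Ham d) : Prop :=
  ∀ (r : ℝ) (b : E d) (A : Matrix (Fin d) (Fin d) ℝ) (p : ℝ × E d),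
    DifferentiableAt ℝ (fun s => H (vcons s b) A p) r →
    deriv (fun s => H (vcons s b) A p) r ≤ -1

/-- Properties of `P`: convex, positively homogeneous of degree one, with
`D_{u''}P ∈ 𝕊_{δ̄}` at points of differentiability. -/
def Pprops (d : ℕ) (δb : ℝ) (P : Matrix (Fin d) (Fin d) ℝ → ℝ) : Prop :=
  ConvexOn ℝ Set.univ P ∧
  (∀ (c : ℝ), 0 ≤ c → ∀ A, P (c • A) = c * P A) ∧
  (∀ A : Matrix (Fin d) (Fin d) ℝ, DifferentiableAt ℝ P A →
    ∃ a ∈ Sdelta d δb, ∀ B, fderiv ℝ P A B = ∑ i, ∑ j, a i j * B i j)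

/-- `u` (with weak derivatives `ut, ux, uxx`) solves
`∂_t u + max(H[u], P[u] - K) = 0` a.e. in `Π` with `u = g` on `∂'Π`, `u ∈ C(Π̄)`. -/
def SolPlus {d : ℕ} (H : Ham d) (P : Matrix (Fin d) (Fin d) ℝ → ℝ) (K T : ℝ) (Ω : Set (E d))
    (g u ut : ℝ × E d → ℝ) (ux : ℝ × E d → E d)
    (uxx : ℝ × E d → Matrix (Fin d) (Fin d) ℝ) : Prop :=
  ContinuousOn u (closure (PiDom T Ω)) ∧
  WeakDerivs (PiDom T Ω) u ut ux uxx ∧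
  (∀ᵐ p ∂(volume.restrict (PiDom T Ω)),
    ut p + max (H (vcons (u p) (ux p)) (uxx p) p) (P (uxx p) - K) = 0) ∧
  Set.EqOn u g (parBdry T Ω)

/-- `u` solves `∂_t u + min(H[u], -P[-u] + K) = 0` a.e. in `Π` with `u = g` on `∂'Π`. -/
def SolMinus {d : ℕ} (H : Ham d) (P : Matrix (Fin d) (Fin d) ℝ → ℝ) (K T : ℝ) (Ω : Set (E d))
    (g u ut : ℝ × E d → ℝ) (ux : ℝ × E d → E d)
    (uxx : ℝ × E d → Matrix (Fin d) (Fin d) ℝ) : Prop :=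
  ContinuousOn u (closure (PiDom T Ω)) ∧
  WeakDerivs (PiDom T Ω) u ut ux uxx ∧
  (∀ᵐ p ∂(volume.restrict (PiDom T Ω)),
    ut p + min (H (vcons (u p) (ux p)) (uxx p) p) (-(P (-(uxx p))) + K) = 0) ∧
  Set.EqOn u g (parBdry T Ω)

/-- Parabolic distance. -/
def parDist {d : ℕ} (p q : ℝ × E d) : ℝ := ‖p.2 - q.2‖ + |p.1 - q.1| ^ ((1 : ℝ) / 2)

/-- `‖u‖_{C^κ(Q)} ≤ C`: bounds on `u`, `Du`, the parabolic Hölder seminorm of order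
`κ-1` of `Du`, and the Hölder seminorm of order `κ/2` of `u` in `t`. -/
def CkappaLE {d : ℕ} (κ : ℝ) (Q : Set (ℝ × E d)) (u : ℝ × E d → ℝ) (C : ℝ) : Prop :=
  (∀ p ∈ Q, |u p| ≤ C) ∧
  (∀ p ∈ Q, DifferentiableAt ℝ (fun y => u (p.1, y)) p.2) ∧
  (∀ p ∈ Q, ‖sgrad u p‖ ≤ C) ∧
  (∀ p ∈ Q, ∀ q ∈ Q, ‖sgrad u p - sgrad u q‖ ≤ C * parDist p q ^ (κ - 1)) ∧
  (∀ p ∈ Q, ∀ q ∈ Q, p.2 = q.2 → |u p - u q| ≤ C * |p.1 - q.1| ^ (κ / 2))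

/-- A nonnegative smooth mollifier, radially symmetric in `x`, supported in
`(-1,0) × B₁`, with unit integral. -/
def StdMollifier {d : ℕ} (ζ : ℝ × E d → ℝ) : Prop :=
  ContDiff ℝ (⊤ : ℕ∞) ζ ∧ HasCompactSupport ζ ∧ (∀ p, 0 ≤ ζ p) ∧
  tsupport ζ ⊆ Set.Ioo (-1 : ℝ) 0 ×ˢ Metric.ball (0 : E d) 1 ∧
  (∀ (t : ℝ) (x y : E d), ‖x‖ = ‖y‖ → ζ (t, x) = ζ (t, y)) ∧
  (∫ p : ℝ × E d, ζ p) = 1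

/-- Parabolic mollification `u^{(ε)} = u * ζ_ε`. -/
def mollify {d : ℕ} (ζ : ℝ × E d → ℝ) (ε : ℝ) (u : ℝ × E d → ℝ) (p : ℝ × E d) : ℝ :=
  ∫ q : ℝ × E d, u (p.1 - ε ^ 2 * q.1, p.2 - ε • q.2) * ζ q

/-- `γ = (7 - 3κ)/(12 - 4κ)`. -/
def gval (κ : ℝ) : ℝ := (7 - 3 * κ) / (12 - 4 * κ)

/-- `ε = ε₀ M^{-1/(κ-1)} K^{-(1-γ)/(2γ)}`. -/
def epsval (κ ε₀ M K : ℝ) : ℝ :=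
  ε₀ * M ^ (-(1 / (κ - 1))) * K ^ (-((1 - gval κ) / (2 * gval κ)))

/-- `η₁⁻¹ = 1 - (2-κ)(1-γ)(2γ)⁻¹`. -/
def eta1 (κ : ℝ) : ℝ := (1 - (2 - κ) * (1 - gval κ) / (2 * gval κ))⁻¹

/-- The function `W(t,x,y)`. -/
def Wfun {d : ℕ} (ζ : ℝ × E d → ℝ) (ν K ε : ℝ) (u v : ℝ × E d → ℝ)
    (q : ℝ × (E d × E d)) : ℝ :=
  u (q.1, q.2.1) - mollify ζ ε u (q.1, q.2.1)
    - (v (q.1, q.2.2) - mollify ζ ε u (q.1, q.2.2)) - ν * K * ‖q.2.1 - q.2.2‖ ^ 2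

/-- The domain of maximization `[0, T-ε²] × (Ω̄^ε)²` for `W`. -/
def Wdom {d : ℕ} (T ε : ℝ) (Ω : Set (E d)) : Set (ℝ × (E d × E d)) :=
  Set.Icc 0 (T - ε ^ 2) ×ˢ (closure (OmRho ε Ω) ×ˢ closure (OmRho ε Ω))

/-- Assumption 4.1 (Assumption B). -/
def AssumptionB {d : ℕ} (δ K₀ : ℝ) (H : Ham d) (Hb : ℝ × E d → ℝ) : Prop :=
  (∀ (r₁ r₂ : ℝ) (b : E d) (A : Matrix (Fin d) (Fin d) ℝ) (p : ℝ × E d),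
    r₁ ≤ r₂ → H (vcons r₂ b) A p ≤ H (vcons r₁ b) A p) ∧
  (∀ ε > (0 : ℝ), ∃ δ' > (0 : ℝ), ∀ (r₁ r₂ : ℝ) (b : E d) (A : Matrix (Fin d) (Fin d) ℝ)
    (p : ℝ × E d), |r₁ - r₂| < δ' → |H (vcons r₁ b) A p - H (vcons r₂ b) A p| < ε) ∧
  (∀ (u' : E (d + 1)) (A : Matrix (Fin d) (Fin d) ℝ), Measurable fun p => H u' A p) ∧
  (∃ L : ℝ, 0 ≤ L ∧ ∀ (r : ℝ) (b₁ b₂ : E d) (A : Matrix (Fin d) (Fin d) ℝ) (p : ℝ × E d),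
    |H (vcons r b₁) A p - H (vcons r b₂) A p| ≤ L * ‖b₁ - b₂‖) ∧
  (∃ L : ℝ, 0 ≤ L ∧ ∀ (u' : E (d + 1)) (A₁ A₂ : Matrix (Fin d) (Fin d) ℝ) (p : ℝ × E d),
    |H u' A₁ p - H u' A₂ p| ≤ L * frob (A₁ - A₂)) ∧
  (∀ (u' : E (d + 1)) (p : ℝ × E d) (A : Matrix (Fin d) (Fin d) ℝ),
    DifferentiableAt ℝ (fun B => H u' B p) A →
    ∃ a ∈ Sdelta d δ, ∀ B, fderiv ℝ (fun B => H u' B p) A B = ∑ i, ∑ j, a i j * B i j) ∧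
  (∀ (u' : E (d + 1)) (p : ℝ × E d), |H u' 0 p| ≤ K₀ * ‖u'‖ + Hb p)

/-- Assumption 4.3 (Assumption C) with parameters `R₀`, `θ`. -/
def AssumptionC {d : ℕ} (δ K₀ R₀ θ : ℝ) (Hb : ℝ × E d → ℝ) (H : Ham d) : Prop :=
  ∃ F : Matrix (Fin d) (Fin d) ℝ → ℝ × E d → ℝ,
    (∀ A, Measurable (F A)) ∧
    (∀ (u' : E (d + 1)) (A : Matrix (Fin d) (Fin d) ℝ) (p : ℝ × E d),
      |H u' A p - F A p| ≤ K₀ * ‖u'‖ + Hb p) ∧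
    (∀ (c : ℝ), 0 ≤ c → ∀ A p, F (c • A) p = c * F A p) ∧
    (∃ L : ℝ, 0 ≤ L ∧ ∀ A₁ A₂ p, |F A₁ p - F A₂ p| ≤ L * frob (A₁ - A₂)) ∧
    (∀ (p : ℝ × E d) (A : Matrix (Fin d) (Fin d) ℝ), DifferentiableAt ℝ (fun B => F B p) A →
      ∃ a ∈ Sdelta d δ, ∀ B, fderiv ℝ (fun B => F B p) A B = ∑ i, ∑ j, a i j * B i j) ∧
    (∀ R : ℝ, 0 < R → R ≤ R₀ → ∀ (p : ℝ × E d) (A : Matrix (Fin d) (Fin d) ℝ),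
      A.IsSymm → frob A = 1 →
      (⨍ q in cylSet R p, |F A q - ⨍ y in Metric.ball p.2 R, F A (q.1, y)|) ≤ θ)

/-- `v` is the maximal `L_q`-viscosity solution of class `C(Π̄)` with boundary datum `g`. -/
def IsMaximalViscSol {d : ℕ} (q : ℝ) (H : Ham d) (T : ℝ) (Ω : Set (E d))
    (g v : ℝ × E d → ℝ) : Prop :=
  ContinuousOn v (closure (PiDom T Ω)) ∧ IsLqViscSol q H (PiDom T Ω) v ∧
  Set.EqOn v g (parBdry T Ω) ∧
  ∀ w : ℝ × E d → ℝ, ContinuousOn w (closure (PiDom T Ω)) →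
    IsLqViscSubsol q H (PiDom T Ω) w → Set.EqOn w g (parBdry T Ω) →
    ∀ p ∈ closure (PiDom T Ω), w p ≤ v p

/-- `v` is the minimal `L_q`-viscosity solution of class `C(Π̄)` with boundary datum `g`. -/
def IsMinimalViscSol {d : ℕ} (q : ℝ) (H : Ham d) (T : ℝ) (Ω : Set (E d))
    (g v : ℝ × E d → ℝ) : Prop :=
  ContinuousOn v (closure (PiDom T Ω)) ∧ IsLqViscSol q H (PiDom T Ω) v ∧
  Set.EqOn v g (parBdry T Ω) ∧
  ∀ w : ℝ × E d → ℝ, ContinuousOn w (closure (PiDom T Ω)) →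
    IsLqViscSupersol q H (PiDom T Ω) w → Set.EqOn w g (parBdry T Ω) →
    ∀ p ∈ closure (PiDom T Ω), v p ≤ w p

/-- The Isaacs operator. -/
def Isaacs {d : ℕ} {A B : Type} (a : A → B → ℝ × E d → Matrix (Fin d) (Fin d) ℝ)
    (b : A → B → E (d + 1) → ℝ × E d → ℝ) : Ham d :=
  fun u' M p => ⨆ α : A, ⨅ β : B, ((∑ i, ∑ j, a α β p i j * M i j) + b α β u' p)

/-- `ℋ₀(ξ, u', t, x) = sup_α inf_β [ξ^{αβ} + b^{αβ}(u',t,x)]`. -/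
def Isaacs0 {d : ℕ} {A B : Type} (b : A → B → E (d + 1) → ℝ × E d → ℝ)
    (ξ : A → B → ℝ) (u' : E (d + 1)) (q : ℝ × E d) : ℝ :=
  ⨆ α : A, ⨅ β : B, (ξ α β + b α β u' q)

/-- `ζ_n(t,x) = n^{d+1} ζ(nt, nx)`. -/
def zetan {d : ℕ} (ζ : ℝ × E d → ℝ) (n : ℕ) (q : ℝ × E d) : ℝ :=
  (n : ℝ) ^ (d + 1) * ζ ((n : ℝ) * q.1, (n : ℝ) • q.2)

/-- `ℋ_n(ξ,u',·) = ℋ₀(ξ,u',·) * ζ_n`. -/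
def IsaacsN {d : ℕ} {A B : Type} (b : A → B → E (d + 1) → ℝ × E d → ℝ)
    (ζ : ℝ × E d → ℝ) (n : ℕ) (ξ : A → B → ℝ) (u' : E (d + 1)) (q : ℝ × E d) : ℝ :=
  ∫ w : ℝ × E d, Isaacs0 b ξ u' (q.1 - w.1, q.2 - w.2) * zetan ζ n w

/-- The matrix inequality from the proof of Theorem 3.1: if
`⟨Aξ,ξ⟩ - ⟨Bη,η⟩ ≤ c|ξ-η|²` for all `ξ, η`, then `B + cI ⪰ 0`, `B + 2cI ≻ 0`,
the matrix `B (B + 2cI)⁻¹` is symmetric, and `A ⪯ 2c · B (B + 2cI)⁻¹`. -/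
theorem stmt10 (d : ℕ) (A B : Matrix (Fin d) (Fin d) ℝ)
    (hA : A.IsSymm) (hB : B.IsSymm) (c : ℝ) (hc : 0 < c)
    (h : ∀ ξ η : Fin d → ℝ,
      dotProduct ξ (A.mulVec ξ) - dotProduct η (B.mulVec η) ≤ c * ∑ i, (ξ i - η i) ^ 2) :
    (B + c • (1 : Matrix (Fin d) (Fin d) ℝ)).PosSemidef ∧
    (B + (2 * c) • (1 : Matrix (Fin d) (Fin d) ℝ)).PosDef ∧
    (B * (B + (2 * c) • (1 : Matrix (Fin d) (Fin d) ℝ))⁻¹).IsSymm ∧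
    ((2 * c) • (B * (B + (2 * c) • (1 : Matrix (Fin d) (Fin d) ℝ))⁻¹) - A).PosSemidef := by
  have hBc : (B + c • (1 : Matrix (Fin d) (Fin d) ℝ)).PosSemidef := by
    refine .of_dotProduct_mulVec_nonneg ?_ fun x => ?_
    · ext i j
      simp [Matrix.one_apply, hB.apply i j, eq_comm]
    · have hx := h 0 x
      have hsum : ∑ i, ((0 : Fin d → ℝ) i - x i) ^ 2 = dotProduct x x := by
        simp [dotProduct, sq]
      rw [hsum] at hx
      simp only [Matrix.mulVec_zero, dotProduct_zero] at hx
      simp only [star_trivial, Matrix.add_mulVec, Matrix.smul_mulVec, Matrix.one_mulVec,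
        dotProduct_add, dotProduct_smul, smul_eq_mul]
      linarith
  have hsplit : B + (2 * c) • (1 : Matrix (Fin d) (Fin d) ℝ) =
      (B + c • (1 : Matrix (Fin d) (Fin d) ℝ)) + c • (1 : Matrix (Fin d) (Fin d) ℝ) := by
    rw [two_mul, add_smul, add_assoc]
  have hM : (B + (2 * c) • (1 : Matrix (Fin d) (Fin d) ℝ)).PosDef := by
    rw [hsplit]
    exact Matrix.PosDef.posSemidef_add hBc (Matrix.PosDef.one.smul hc)
  have hcomm : Commute B (B + (2 * c) • (1 : Matrix (Fin d) (Fin d) ℝ)) :=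
    (Commute.refl B).add_right ((Commute.one_right B).smul_right _)
  have hMsymm : (B + (2 * c) • (1 : Matrix (Fin d) (Fin d) ℝ)).IsSymm :=
    hB.add (Matrix.isSymm_one.smul _)
  have hdet : IsUnit (B + (2 * c) • (1 : Matrix (Fin d) (Fin d) ℝ)).det :=
    (Matrix.isUnit_iff_isUnit_det _).1 hM.isUnit
  set M := B + (2 * c) • (1 : Matrix (Fin d) (Fin d) ℝ) with hMdef
  have hcommInv : M⁻¹ * B = B * M⁻¹ := by
    calc M⁻¹ * B = M⁻¹ * (B * M) * M⁻¹ := by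
          rw [mul_assoc, Matrix.mul_nonsing_inv_cancel_right _ _ hdet]
      _ = B * M⁻¹ := by rw [hcomm.eq, Matrix.nonsing_inv_mul_cancel_left _ _ hdet]
  have hsymm : (B * M⁻¹).IsSymm := by
    rw [Matrix.IsSymm, Matrix.transpose_mul, Matrix.transpose_nonsing_inv, hMsymm.eq, hB.eq,
      hcommInv]
  refine ⟨hBc, hM, hsymm, .of_dotProduct_mulVec_nonneg ?_ fun x => ?_⟩
  · rw [Matrix.IsHermitian, Matrix.conjTranspose_eq_transpose_of_trivial]
    exact ((hsymm.smul _).sub hA).eq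
  · obtain ⟨z, rfl⟩ : ∃ z, x = M.mulVec z :=
      ⟨M⁻¹.mulVec x, by rw [Matrix.mulVec_mulVec, Matrix.mul_nonsing_inv _ hdet,
        Matrix.one_mulVec]⟩
    have hx := h (M.mulVec z) ((2 * c) • z)
    have hMz : M.mulVec z = B.mulVec z + (2 * c) • z := by
      simp only [hMdef, Matrix.add_mulVec, Matrix.smul_mulVec, Matrix.one_mulVec]
    have hsum : ∑ i, (M.mulVec z i - ((2 * c) • z) i) ^ 2
        = dotProduct (B.mulVec z) (B.mulVec z) := by
      simp [hMz, dotProduct, sq]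
    have hBM : (B * M⁻¹).mulVec (M.mulVec z) = B.mulVec z := by
      rw [Matrix.mulVec_mulVec, Matrix.nonsing_inv_mul_cancel_right _ _ hdet]
    have hnonneg : 0 ≤ c * dotProduct (B.mulVec z) (B.mulVec z) :=
      mul_nonneg hc.le (Finset.sum_nonneg fun i _ => mul_self_nonneg _)
    have hquad : dotProduct (M.mulVec z) ((2 * c) • B.mulVec z) =
        2 * c * dotProduct (B.mulVec z) (B.mulVec z) +
          2 * c * (2 * c * dotProduct z (B.mulVec z)) := by
      rw [hMz, add_dotProduct, smul_dotProduct, dotProduct_smul, dotProduct_smul]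
      simp only [smul_eq_mul]
    rw [hsum] at hx
    simp only [Matrix.mulVec_smul, smul_dotProduct, dotProduct_smul, smul_eq_mul] at hx
    rw [star_trivial, Matrix.sub_mulVec, Matrix.smul_mulVec, hBM, dotProduct_sub, hquad]
    linarith

end Krylov
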